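/- Let h = 2n+1 be an odd integer with n ≥ 1, let τ be an h-bar-core, and let λ, μ ∈ P_{τ,2}. If λ and μ are incomparable in the dominance order (neither λ ⊴ μ nor μ ⊴ λ), then |∂λ − ∂μ| ≥ 2. -/

import Mathlib

/-- A partition: a weakly decreasing sequence of non-negative integers with
finite sum (finitely many nonzero parts), indexed from 0 (so `parts 0` is λ₁). -/
structure BPartition where
  parts : ℕ →₀ ℕ
  antitone : ∀ r, parts (r + 1) ≤ parts r

namespace BPartition

/-- The multiset of positive parts of a partition. -/
def partsM (lam : BPartition) : Multiset ℕ :=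
  lam.parts.support.val.map (fun r => lam.parts r)

/-- The Young diagram: nodes `(r, c)` with rows indexed from 0 and columns from 1. -/
def diagram (lam : BPartition) : Set (ℕ × ℕ) :=
  {x | 1 ≤ x.2 ∧ x.2 ≤ lam.parts x.1}

/-- A partition is strict if λ_r > λ_{r+1} whenever λ_r > 0. -/
def IsStrict (lam : BPartition) : Prop :=
  ∀ r, 0 < lam.parts r → lam.parts (r + 1) < lam.parts r

/-- A partition is h-strict if each part is either strictly bigger than the next,
or positive and divisible by h, or zero. -/
def IsHStrict (h : ℕ) (lam : BPartition) : Prop :=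
  ∀ r, lam.parts (r + 1) < lam.parts r ∨ (0 < lam.parts r ∧ h ∣ lam.parts r) ∨ lam.parts r = 0

/-- An h-strict partition is restricted if for every r either λ_{r+1} > λ_r − h,
or λ_{r+1} = λ_r − h and h does not divide λ_r. -/
def IsRestricted (h : ℕ) (lam : BPartition) : Prop :=
  ∀ r, lam.parts r < lam.parts (r + 1) + h ∨
    (lam.parts (r + 1) + h = lam.parts r ∧ ¬ h ∣ lam.parts r)

/-- The residue of a node in column c (1-indexed): the smaller of the residues of
c − 1 and of −c modulo h. -/
def colRes (h c : ℕ) : ℕ := min ((c - 1) % h) ((h - c % h) % h)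

/-- `x` is an addable i-node of `lam`. -/
def Addable (h i : ℕ) (lam : BPartition) (x : ℕ × ℕ) : Prop :=
  colRes h x.2 = i ∧ x ∉ diagram lam ∧
  ∃ nu : BPartition, IsHStrict h nu ∧ diagram lam ⊆ diagram nu ∧ x ∈ diagram nu ∧
    ∀ y ∈ diagram nu, y ∉ diagram lam → colRes h y.2 = i

/-- `x` is a removable i-node of `lam`. -/
def Removable (h i : ℕ) (lam : BPartition) (x : ℕ × ℕ) : Prop :=
  x ∈ diagram lam ∧
  ∃ mu : BPartition, IsHStrict h mu ∧ diagram mu ⊆ diagram lam ∧ x ∉ diagram mu ∧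
    ∀ y ∈ diagram lam, y ∉ diagram mu → colRes h y.2 = i

/-- Removal of a single h-bar from `lam` giving `mu`, recording the value `v`:
either a part `v ≥ h` is replaced by `v − h` (deleted if `v = h`), or two parts
summing to `h` are deleted, in which case `v` is the larger of the two. -/
def barStepRec (h : ℕ) (lam mu : BPartition) (v : ℕ) : Prop :=
  IsHStrict h mu ∧
  ((v = h ∧ v ∈ partsM lam ∧ partsM mu = (partsM lam).erase v) ∨
   (h < v ∧ v ∈ partsM lam ∧ partsM mu = (v - h) ::ₘ (partsM lam).erase v) ∨
   (∃ a b : ℕ, a + b = h ∧ a ∈ partsM lam ∧ b ∈ (partsM lam).erase a ∧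
      v = max a b ∧ partsM mu = ((partsM lam).erase a).erase b))

/-- Removal of a single h-bar. -/
def barStep (h : ℕ) (lam mu : BPartition) : Prop :=
  ∃ v, barStepRec h lam mu v

/-- An h-bar-core: an h-strict partition from which no h-bar can be removed. -/
def IsBarCore (h : ℕ) (lam : BPartition) : Prop :=
  IsHStrict h lam ∧ ∀ mu, ¬ barStep h lam mu

/-- A chain of `w` h-bar removals from `lam` down to `mu`. -/
def barChain (h : ℕ) : ℕ → BPartition → BPartition → Prop
  | 0, lam, mu => lam = mu
  | w + 1, lam, mu => ∃ nu, barStep h lam nu ∧ barChain h w nu mu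

/-- `lam ∈ P_{τ,w}`: `lam` is h-strict with h-bar-core `tau` and h-bar-weight `w`. -/
def InBlock (h : ℕ) (tau : BPartition) (w : ℕ) (lam : BPartition) : Prop :=
  IsHStrict h lam ∧ IsBarCore h tau ∧ barChain h w lam tau

/-- The left-to-right order on node positions along the edge of a Young diagram:
smaller column first; within a column, larger row first. -/
def posLE (x y : ℕ × ℕ) : Prop := x.2 < y.2 ∨ (x.2 = y.2 ∧ y.1 ≤ x.1)

/-- `x` is a normal i-node: a removable i-node surviving (as a − sign) in the
reduced i-signature; equivalently, every window of the i-signature ending at `x`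
contains strictly more removable than addable i-nodes. -/
def Normal (h i : ℕ) (lam : BPartition) (x : ℕ × ℕ) : Prop :=
  Removable h i lam x ∧ ∀ z : ℕ × ℕ, posLE z x →
    Set.ncard {y | Addable h i lam y ∧ posLE z y ∧ posLE y x} <
      Set.ncard {y | Removable h i lam y ∧ posLE z y ∧ posLE y x}

/-- `x` is a conormal i-node: an addable i-node surviving (as a + sign) in the
reduced i-signature. -/
def Conormal (h i : ℕ) (lam : BPartition) (x : ℕ × ℕ) : Prop :=
  Addable h i lam x ∧ ∀ z : ℕ × ℕ, posLE x z →
    Set.ncard {y | Removable h i lam y ∧ posLE x y ∧ posLE y z} <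
      Set.ncard {y | Addable h i lam y ∧ posLE x y ∧ posLE y z}

/-- The node set of ψ_i(λ): add the leftmost s − r conormal i-nodes if s ≥ r,
remove the rightmost r − s normal i-nodes if r > s, where r = #normal and
s = #conormal i-nodes. -/
noncomputable def psiSet (h i : ℕ) (lam : BPartition) : Set (ℕ × ℕ) :=
  if Set.ncard {x | Normal h i lam x} ≤ Set.ncard {x | Conormal h i lam x} then
    diagram lam ∪ {x | Conormal h i lam x ∧
      Set.ncard {y | Conormal h i lam y ∧ posLE y x} ≤
        Set.ncard {x | Conormal h i lam x} - Set.ncard {x | Normal h i lam x}}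
  else
    diagram lam \ {x | Normal h i lam x ∧
      Set.ncard {y | Normal h i lam y ∧ posLE x y} ≤
        Set.ncard {x | Normal h i lam x} - Set.ncard {x | Conormal h i lam x}}

open Classical in
/-- The involution ψ_i. -/
noncomputable def psi (h i : ℕ) (lam : BPartition) : BPartition :=
  if hex : ∃ mu : BPartition, diagram mu = psiSet h i lam then hex.choose else lam

/-- The set of occupied positions of the abacus display of a strict partition. -/
def abacus (lam : BPartition) : Set ℤ :=
  {a | a = 0 ∨ (0 < a ∧ a.toNat ∈ partsM lam) ∨ (a < 0 ∧ (-a).toNat ∉ partsM lam)}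

/-- The dominance order: λ ⊴ μ. -/
def domLE (lam mu : BPartition) : Prop :=
  ∀ r, ∑ s ∈ Finset.range r, lam.parts s ≤ ∑ s ∈ Finset.range r, mu.parts s

/-- Strict dominance: λ ◁ μ. -/
def domLT (lam mu : BPartition) : Prop := domLE lam mu ∧ lam ≠ mu

/-- Lexicographic order: λ <lex μ. -/
def lexLT (lam mu : BPartition) : Prop :=
  ∃ r, lam.parts r < mu.parts r ∧ ∀ s < r, lam.parts s = mu.parts s

/-- Colexicographic order: λ <colex μ. -/
def colexLT (lam mu : BPartition) : Prop :=
  ∃ r, mu.parts r < lam.parts r ∧ ∀ s, r < s → lam.parts s = mu.parts s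

/-- λ ↔ᵢ μ: every node of the symmetric difference of the diagrams has residue i. -/
def Link (h i : ℕ) (lam mu : BPartition) : Prop :=
  ∀ x : ℕ × ℕ, x ∈ (diagram lam \ diagram mu) ∪ (diagram mu \ diagram lam) →
    colRes h x.2 = i

/-- `a ≤ b` are the bar positions of `lam ∈ P_{τ,2}`: the values recorded by
some two-step removal of h-bars from `lam` down to `tau`. -/
def BarPositions (h : ℕ) (tau lam : BPartition) (a b : ℕ) : Prop :=
  a ≤ b ∧ ∃ (nu : BPartition) (v₁ v₂ : ℕ), barStepRec h lam nu v₁ ∧ barStepRec h nu tau v₂ ∧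
    ({a, b} : Multiset ℕ) = {v₁, v₂}

/-- The leg length of the bar of `lam ∈ P_{τ,2}` at bar position `c`. -/
noncomputable def legLen (h : ℕ) (tau lam : BPartition) (c : ℕ) : ℕ :=
  if h ≤ c then Set.ncard {x : ℕ | c - h < x ∧ x < c ∧ x ∈ partsM lam ∧ x ∈ partsM tau}
  else (h - c) + Set.ncard {x : ℕ | h - c < x ∧ x < c ∧ x ∈ partsM lam ∧ x ∈ partsM tau}

/-- ∂λ: the absolute difference of the two leg lengths of `lam`, whose bar
positions are `a ≤ b`. -/
noncomputable def ddd (h : ℕ) (tau lam : BPartition) (a b : ℕ) : ℕ :=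
  max (legLen h tau lam a) (legLen h tau lam b) - min (legLen h tau lam a) (legLen h tau lam b)

inductive Colour | black | white | grey
deriving DecidableEq

/-- β(τ): the number of parts of τ less than h. -/
def betaCount (h : ℕ) (tau : BPartition) : ℕ :=
  Multiset.card ((partsM tau).filter (fun x => x < h))

/-- The leg length of a 2h-bar of `lam` with larger bar position `b`. -/
noncomputable def legLen2 (h : ℕ) (tau lam : BPartition) (b : ℕ) : ℕ :=
  if 2 * h ≤ b then Set.ncard {x : ℕ | b - 2 * h < x ∧ x < b ∧ x ∈ partsM lam ∧ x ∈ partsM tau}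
  else (2 * h - b) + Set.ncard {x : ℕ | 2 * h - b < x ∧ x < b ∧ x ∈ partsM lam ∧ x ∈ partsM tau}

/-- The colour of `lam ∈ P_{τ,2}` with bar positions `a ≤ b`. -/
noncomputable def colour (h : ℕ) (tau lam : BPartition) (a b : ℕ) : Colour :=
  if 2 ≤ ddd h tau lam a b then Colour.grey
  else if ddd h tau lam a b = 1 then
    if h < b then Colour.grey
    else if (min (legLen h tau lam a) (legLen h tau lam b) + betaCount h tau) % 2 = 1 then
      Colour.black else Colour.white
  else
    if b = a + h ∨ a + b = 2 * h then
      if (legLen2 h tau lam b + 2 * betaCount h tau) % 4 = 0 ∨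
         (legLen2 h tau lam b + 2 * betaCount h tau) % 4 = 3 then Colour.black
      else Colour.white
    else
      if (legLen h tau lam a + betaCount h tau) % 2 = 1 then Colour.black else Colour.white

end BPartition

namespace Bar12
open BPartition

lemma pos_of_mem {l : BPartition} {x : ℕ} (hx : x ∈ partsM l) : 0 < x := by
  unfold partsM at hx
  rw [Multiset.mem_map] at hx
  obtain ⟨r, hr, rfl⟩ := hx
  have : r ∈ l.parts.support := hr
  rw [Finsupp.mem_support_iff] at this
  omega

lemma anti (l : BPartition) : Antitone l.parts := antitone_nat_of_succ_le l.antitone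

lemma count_le {h : ℕ} {l : BPartition} (hl : IsHStrict h l) {x : ℕ} (hx : ¬ h ∣ x) :
    (partsM l).count x ≤ 1 := by
  unfold partsM
  rw [Multiset.count_map]
  change (l.parts.support.filter (fun a => x = l.parts a)).card ≤ 1
  rw [Finset.card_le_one]
  have key : ∀ a b, a ∈ l.parts.support.filter (fun a => x = l.parts a) →
      b ∈ l.parts.support.filter (fun a => x = l.parts a) → ¬ a < b := by
    intro a b ha hb hab
    simp only [Finset.mem_filter, Finsupp.mem_support_iff] at ha hb
    have h1 := anti l (show a + 1 ≤ b from hab)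
    rcases hl a with h2 | h2 | h2
    · omega
    · rw [← ha.2] at h2; exact hx h2.2
    · exact ha.1 h2
  intro a ha b hb
  rcases lt_trichotomy a b with h1 | h1 | h1
  · exact absurd h1 (key a b ha hb)
  · exact h1
  · exact absurd h1 (key b a hb ha)

lemma exists_part {h : ℕ} (s : Multiset ℕ) (hpos : ∀ x ∈ s, 0 < x)
    (hc : ∀ x, ¬ h ∣ x → s.count x ≤ 1) :
    ∃ l : BPartition, partsM l = s ∧ IsHStrict h l := by
  obtain ⟨L, hLs, hsorted⟩ : ∃ L : List ℕ, (L : Multiset ℕ) = s ∧ L.Pairwise (· ≥ ·) :=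
    ⟨s.sort (· ≥ ·), Multiset.sort_eq s _, Multiset.pairwise_sort s _⟩
  have hLpos : ∀ x ∈ L, 0 < x := by
    intro x hx; apply hpos; rw [← hLs]; exact hx
  have hget : ∀ r, L.toFinsupp r = L.getD r 0 := fun r => rfl
  refine ⟨⟨L.toFinsupp, ?_⟩, ?_, ?_⟩
  · intro r
    rw [hget, hget]
    by_cases hr : r + 1 < L.length
    · rw [List.getD_eq_getElem _ _ hr, List.getD_eq_getElem _ _ (by omega)]
      exact List.pairwise_iff_getElem.1 hsorted r (r+1) (by omega) hr (by omega)
    · rw [List.getD_eq_default _ _ (by omega)]; omega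
  · unfold partsM
    have hsup : L.toFinsupp.support = Finset.range L.length := by
      ext r
      rw [Finsupp.mem_support_iff, hget, Finset.mem_range]
      constructor
      · intro h1; by_contra h2; exact h1 (List.getD_eq_default _ _ (by omega))
      · intro h1
        rw [List.getD_eq_getElem _ _ h1]
        have := hLpos _ (List.getElem_mem h1)
        omega
    show L.toFinsupp.support.val.map (fun r => L.toFinsupp r) = s
    rw [hsup, ← hLs]
    simp only [hget]
    rw [Finset.range_val, Multiset.range, Multiset.map_coe]
    congr 1
    apply List.ext_getElem
    · simp
    · intro i h1 h2
      rw [List.getElem_map, List.getElem_range, List.getD_eq_getElem _ _ h2]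
  · intro r
    show L.toFinsupp (r+1) < L.toFinsupp r ∨ (0 < L.toFinsupp r ∧ h ∣ L.toFinsupp r) ∨ L.toFinsupp r = 0
    rw [hget, hget]
    by_cases hr : r + 1 < L.length
    · rw [List.getD_eq_getElem _ _ hr, List.getD_eq_getElem _ _ (by omega)]
      have h1 := List.pairwise_iff_getElem.1 hsorted r (r+1) (by omega) hr (by omega)
      have h2 := hLpos _ (List.getElem_mem hr)
      by_cases h3 : h ∣ L[r]
      · right; left; exact ⟨by omega, h3⟩
      · left
        rcases lt_or_eq_of_le h1 with h4 | h4
        · exact h4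
        · exfalso
          have h5 := hc _ h3
          rw [← hLs, Multiset.coe_count] at h5
          have : 2 ≤ L.count L[r] := by
            rw [← List.duplicate_iff_two_le_count]
            rw [List.duplicate_iff_exists_distinct_get]
            refine ⟨⟨r, by omega⟩, ⟨r+1, hr⟩, ?_, ?_, ?_⟩
            · show r < r + 1; omega
            · rfl
            · exact h4.symm
          omega
    · rw [List.getD_eq_default _ _ (by omega)]; omega

def fsum (s : Multiset ℕ) (x : ℕ) : ℕ := (s.map (fun p => p - x)).sum

lemma fsum_cons (a : ℕ) (s : Multiset ℕ) (x : ℕ) : fsum (a ::ₘ s) x = (a - x) + fsum s x := by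
  simp [fsum]

lemma fsum_eq (l : BPartition) (x M : ℕ) (hM : ∀ r, M ≤ r → l.parts r = 0) :
    fsum (partsM l) x = ∑ r ∈ Finset.range M, (l.parts r - x) := by
  unfold fsum partsM
  rw [Multiset.map_map]
  show ∑ r ∈ l.parts.support, (l.parts r - x) = _
  apply Finset.sum_subset
  · intro r hr
    rw [Finsupp.mem_support_iff] at hr
    rw [Finset.mem_range]
    by_contra h1
    exact hr (hM r (by omega))
  · intro r _ hr
    rw [Finsupp.notMem_support_iff] at hr
    omega

lemma exists_bound (l : BPartition) : ∃ M, ∀ r, M ≤ r → l.parts r = 0 := by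
  refine ⟨l.parts.support.sup id + 1, fun r hr => ?_⟩
  by_contra h1
  have := Finset.le_sup (f := id) (Finsupp.mem_support_iff.2 h1)
  simp only [id] at this
  omega

lemma dom_of_fsum {l m : BPartition} (H : ∀ x, fsum (partsM l) x ≤ fsum (partsM m) x) :
    domLE l m := by
  intro r
  obtain ⟨M1, h1⟩ := exists_bound l
  obtain ⟨M2, h2⟩ := exists_bound m
  set M := M1 + M2 + r
  set x := m.parts r
  have e1 := fsum_eq l x M (fun r hr => h1 r (by omega))
  have e2 := fsum_eq m x M (fun r hr => h2 r (by omega))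
  have e3 : ∑ s ∈ Finset.range r, (l.parts s - x) ≤ ∑ s ∈ Finset.range M, (l.parts s - x) :=
    Finset.sum_le_sum_of_subset (Finset.range_subset_range.2 (by omega))
  have e4 : ∑ s ∈ Finset.range M, (m.parts s - x) = ∑ s ∈ Finset.range r, (m.parts s - x) := by
    symm
    apply Finset.sum_subset (Finset.range_subset_range.2 (by omega))
    intro s _ hs
    rw [Finset.mem_range] at hs
    have := anti m (show r ≤ s by omega)
    omega
  have e5 : ∑ s ∈ Finset.range r, l.parts s ≤ ∑ s ∈ Finset.range r, (l.parts s - x) + ∑ s ∈ Finset.range r, x := by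
    rw [← Finset.sum_add_distrib]
    exact Finset.sum_le_sum (fun s _ => by omega)
  have e6 : ∑ s ∈ Finset.range r, m.parts s = ∑ s ∈ Finset.range r, (m.parts s - x) + ∑ s ∈ Finset.range r, x := by
    rw [← Finset.sum_add_distrib]
    apply Finset.sum_congr rfl
    intro s hs
    rw [Finset.mem_range] at hs
    have := anti m hs.le
    omega
  have := H x
  omega

def gf (h c x : ℕ) : ℕ := if h ≤ c then (c - x) - (c - h - x) else (c - x) + (h - c - x)

lemma step_inv {n h : ℕ} (hh : h = 2 * n + 1) {lam mu : BPartition} {v : ℕ}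
    (H : barStepRec h lam mu v) :
    (v = h ∧ partsM lam = h ::ₘ partsM mu) ∨
    (h < v ∧ v - h ∈ partsM mu ∧ partsM lam = v ::ₘ (partsM mu).erase (v - h)) ∨
    (n < v ∧ v < h ∧ partsM lam = v ::ₘ (h - v) ::ₘ partsM mu) := by
  obtain ⟨-, ⟨h1, h2, h3⟩ | ⟨h1, h2, h3⟩ | ⟨a, b, h1, h2, h3, h4, h5⟩⟩ := H
  · left
    subst h1
    exact ⟨rfl, by rw [h3, Multiset.cons_erase h2]⟩
  · right; left
    refine ⟨h1, by rw [h3]; exact Multiset.mem_cons_self _ _, ?_⟩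
    rw [h3, Multiset.erase_cons_head, Multiset.cons_erase h2]
  · right; right
    have pa := pos_of_mem h2
    have pb := pos_of_mem (Multiset.mem_of_mem_erase h3)
    have e : partsM lam = a ::ₘ b ::ₘ partsM mu := by
      rw [h5, Multiset.cons_erase h3, Multiset.cons_erase h2]
    rcases le_total a b with h6 | h6
    · rw [max_eq_right h6] at h4
      subst h4
      refine ⟨by omega, by omega, ?_⟩
      rw [e, show h - v = a by omega, Multiset.cons_swap]
    · rw [max_eq_left h6] at h4
      subst h4
      refine ⟨by omega, by omega, ?_⟩
      rw [e, show h - v = b by omega]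

lemma fsum_step {n h : ℕ} (hh : h = 2 * n + 1) {lam mu : BPartition} {v : ℕ}
    (H : barStepRec h lam mu v) (x : ℕ) :
    fsum (partsM lam) x = fsum (partsM mu) x + gf h v x := by
  rcases step_inv hh H with ⟨h1, h2⟩ | ⟨h1, h2, h3⟩ | ⟨h1, h2, h3⟩
  · rw [h2, fsum_cons, gf, if_pos (by omega)]; omega
  · have e : fsum (partsM mu) x = (v - h - x) + fsum ((partsM mu).erase (v - h)) x := by
      rw [← fsum_cons, Multiset.cons_erase h2]
    rw [h3, fsum_cons, gf, if_pos (by omega)]; omega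
  · rw [h3, fsum_cons, fsum_cons, gf, if_neg (by omega)]; omega

structure Core (h : ℕ) (T : Multiset ℕ) : Prop where
  pos : ∀ x ∈ T, 0 < x
  nd : T.Nodup
  ndvd : ∀ x ∈ T, ¬ h ∣ x
  down : ∀ x ∈ T, h < x → x - h ∈ T
  pair : ∀ x ∈ T, ∀ y ∈ T, x + y ≠ h

lemma core_of {n h : ℕ} (hh : h = 2 * n + 1) {tau : BPartition} (H : IsBarCore h tau) :
    Core h (partsM tau) := by
  obtain ⟨hs, hno⟩ := H
  have hc : ∀ x, ¬ h ∣ x → (partsM tau).count x ≤ 1 := fun x hx => count_le hs hx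
  have hnd : ∀ x ∈ partsM tau, ¬ h ∣ x := by
    intro x hx hd
    have px := pos_of_mem hx
    have hle := Nat.le_of_dvd px hd
    rcases eq_or_lt_of_le hle with he | hlt
    · obtain ⟨m, hm, hms⟩ := exists_part (h := h) ((partsM tau).erase x)
        (fun y hy => pos_of_mem (Multiset.mem_of_mem_erase hy))
        (fun y hy => (Multiset.count_le_of_le _ (Multiset.erase_le _ _)).trans (hc y hy))
      exact hno m ⟨x, hms, Or.inl ⟨he.symm, hx, hm⟩⟩
    · obtain ⟨m, hm, hms⟩ := exists_part (h := h) ((x - h) ::ₘ (partsM tau).erase x)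
        (by
          intro y hy
          rcases Multiset.mem_cons.1 hy with h1 | h1
          · omega
          · exact pos_of_mem (Multiset.mem_of_mem_erase h1))
        (by
          intro y hy
          rw [Multiset.count_cons_of_ne]
          · exact (Multiset.count_le_of_le _ (Multiset.erase_le _ _)).trans (hc y hy)
          · rintro rfl
            exact hy (Nat.dvd_sub hd (dvd_refl h)))
      exact hno m ⟨x, hms, Or.inr (Or.inl ⟨hlt, hx, hm⟩)⟩
  refine ⟨fun x hx => pos_of_mem hx, ?_, hnd, ?_, ?_⟩
  · rw [Multiset.nodup_iff_count_le_one]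
    intro x
    by_cases hx : x ∈ partsM tau
    · exact hc x (hnd x hx)
    · rw [Multiset.count_eq_zero_of_notMem hx]; omega
  · intro x hx hlt
    by_contra hn
    obtain ⟨m, hm, hms⟩ := exists_part (h := h) ((x - h) ::ₘ (partsM tau).erase x)
        (by
          intro y hy
          rcases Multiset.mem_cons.1 hy with h1 | h1
          · omega
          · exact pos_of_mem (Multiset.mem_of_mem_erase h1))
        (by
          intro y hy
          have h2 := (Multiset.count_le_of_le y (Multiset.erase_le x (partsM tau))).trans (hc y hy)
          by_cases h1 : y = x - h
          · subst h1
            have h3 := Multiset.count_le_of_le (x - h) (Multiset.erase_le x (partsM tau))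
            rw [Multiset.count_eq_zero_of_notMem hn] at h3
            rw [Multiset.count_cons_self]; omega
          · rw [Multiset.count_cons_of_ne h1]; exact h2)
    exact hno m ⟨x, hms, Or.inr (Or.inl ⟨hlt, hx, hm⟩)⟩
  · intro x hx y hy he
    obtain ⟨m, hm, hms⟩ := exists_part (h := h) (((partsM tau).erase x).erase y)
        (fun z hz => pos_of_mem (Multiset.mem_of_mem_erase (Multiset.mem_of_mem_erase hz)))
        (fun z hz => (Multiset.count_le_of_le _ ((Multiset.erase_le _ _).trans
          (Multiset.erase_le _ _))).trans (hc z hz))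
    refine hno m ⟨max x y, hms, Or.inr (Or.inr ⟨x, y, he, hx, ?_, rfl, hm⟩)⟩
    rw [Multiset.mem_erase_of_ne (by omega)]
    exact hy

/-- addable bar positions of the core -/
def Cpos (n h : ℕ) (T : Multiset ℕ) (c : ℕ) : Prop :=
  n < c ∧ c ∉ T ∧ (h < c → c - h ∈ T) ∧ (c < h → h - c ∉ T)

lemma notdvd_sub {h v : ℕ} (h1 : h < v) (h2 : ¬ h ∣ v - h) : ¬ h ∣ v := by
  intro h3; exact h2 (Nat.dvd_sub h3 (dvd_refl h))

lemma notdvd_lt {h v : ℕ} (h0 : 0 < v) (h1 : v < h) : ¬ h ∣ v := by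
  intro h3; have := Nat.le_of_dvd h0 h3; omega

/-- facts from adding a bar to a nodup h-strict multiset -/
lemma first_step {n h : ℕ} (hn : 1 ≤ n) (hh : h = 2 * n + 1) {nu tau : BPartition} {v : ℕ}
    (hT : Core h (partsM tau)) (hnu : IsHStrict h nu) (H : barStepRec h nu tau v) :
    Cpos n h (partsM tau) v ∧ (partsM nu).Nodup ∧ (∀ x ∈ partsM nu, h ∣ x → x = h ∧ v = h) ∧
    ∀ x, x ∈ partsM nu ↔ (x = v ∨ (v < h ∧ x + v = h) ∨ (x ∈ partsM tau ∧ x + h ≠ v)) := by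
  have hnh : h ∉ partsM tau := fun h1 => hT.ndvd h h1 (dvd_refl h)
  have hpos := hT.pos
  rcases step_inv hh H with ⟨h1, h2⟩ | ⟨h1, h2, h3⟩ | ⟨h1, h2, h3⟩
  · refine ⟨⟨by omega, by rw [h1]; exact hnh, by omega, by omega⟩, ?_, ?_, ?_⟩
    · rw [h2, Multiset.nodup_cons]; exact ⟨hnh, hT.nd⟩
    · intro x hx hd
      rw [h2, Multiset.mem_cons] at hx
      rcases hx with hx | hx
      · exact ⟨hx, h1⟩
      · exact absurd hd (hT.ndvd x hx)
    · intro x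
      rw [h2, Multiset.mem_cons]
      have := hpos x
      constructor
      · rintro (h3 | h3)
        · left; omega
        · right; right; exact ⟨h3, by have := this h3; omega⟩
      · rintro (h3 | h3 | h3)
        · left; omega
        · omega
        · right; exact h3.1
  · have hd : ¬ h ∣ v := notdvd_sub h1 (hT.ndvd _ h2)
    have hv : v ∉ partsM tau := by
      intro hv
      have h4 := count_le hnu hd
      rw [h3, Multiset.count_cons_self] at h4
      have h5 : v ∈ (partsM tau).erase (v - h) := by
        rw [Multiset.mem_erase_of_ne (by omega)]; exact hv
      have := Multiset.count_pos.2 h5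
      omega
    have hm : ∀ x, x ∈ partsM nu ↔ (x = v ∨ (v < h ∧ x + v = h) ∨ (x ∈ partsM tau ∧ x + h ≠ v)) := by
      intro x
      rw [h3, Multiset.mem_cons, hT.nd.mem_erase_iff]
      constructor
      · rintro (h4 | h4)
        · left; exact h4
        · right; right; exact ⟨h4.2, by omega⟩
      · rintro (h4 | h4 | h4)
        · left; exact h4
        · omega
        · right; exact ⟨by omega, h4.1⟩
    refine ⟨⟨by omega, hv, fun _ => h2, by omega⟩, ?_, ?_, hm⟩
    · rw [h3, Multiset.nodup_cons]
      exact ⟨fun h4 => hv (Multiset.mem_of_mem_erase h4), hT.nd.erase _⟩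
    · intro x hx hdx
      rcases (hm x).1 hx with h4 | h4 | h4
      · rw [h4] at hdx; exact absurd hdx hd
      · omega
      · exact absurd hdx (hT.ndvd x h4.1)
  · have e1 := count_le hnu (notdvd_lt (v := v) (by omega) h2)
    have e2 := count_le hnu (notdvd_lt (h := h) (v := h - v) (by omega) (by omega))
    rw [h3, Multiset.count_cons_self] at e1
    rw [h3, Multiset.cons_swap, Multiset.count_cons_self] at e2
    have g1 : v ∉ (h - v) ::ₘ partsM tau := by
      intro h4; have := Multiset.count_pos.2 h4; omega
    have g2 : h - v ∉ v ::ₘ partsM tau := by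
      intro h4; have := Multiset.count_pos.2 h4; omega
    have g3 : v ∉ partsM tau := fun h4 => g1 (Multiset.mem_cons_of_mem h4)
    have g4 : h - v ∉ partsM tau := fun h4 => g2 (Multiset.mem_cons_of_mem h4)
    have hm : ∀ x, x ∈ partsM nu ↔ (x = v ∨ (v < h ∧ x + v = h) ∨ (x ∈ partsM tau ∧ x + h ≠ v)) := by
      intro x
      rw [h3, Multiset.mem_cons, Multiset.mem_cons]
      constructor
      · rintro (h4 | h4 | h4)
        · left; exact h4
        · right; left; omega
        · right; right; exact ⟨h4, by omega⟩
      · rintro (h4 | h4 | h4)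
        · left; exact h4
        · right; left; omega
        · right; right; exact h4.1
    refine ⟨⟨by omega, g3, by omega, fun _ => g4⟩, ?_, ?_, hm⟩
    · rw [h3, Multiset.nodup_cons, Multiset.nodup_cons]
      exact ⟨g1, g4, hT.nd⟩
    · intro x hx hdx
      rcases (hm x).1 hx with h4 | h4 | h4
      · rw [h4] at hdx; exact absurd hdx (notdvd_lt (by omega) h2)
      · exact absurd hdx (notdvd_lt (by omega) (by omega))
      · exact absurd hdx (hT.ndvd x h4.1)

lemma second_step {n h : ℕ} (hn : 1 ≤ n) (hh : h = 2 * n + 1) {lam nu tau : BPartition} {v w : ℕ}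
    (hT : Core h (partsM tau)) (hnu : IsHStrict h nu) (hlam : IsHStrict h lam)
    (H : barStepRec h nu tau v) (H2 : barStepRec h lam nu w) :
    (Cpos n h (partsM tau) v ∧ Cpos n h (partsM tau) w ∧ v ≠ w ∧
      ∀ x ∈ partsM tau, (x ∈ partsM lam ↔ x + h ≠ v ∧ x + h ≠ w)) ∨
    (Cpos n h (partsM tau) v ∧ n < w ∧ (w = v + h ∨ v = w + h ∨ v + w = 2 * h) ∧
      ∀ x ∈ partsM tau, x + h ≠ min v w → x ∈ partsM lam) := by
  have hnh : h ∉ partsM tau := fun h1 => hT.ndvd h h1 (dvd_refl h)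
  have hpos := hT.pos
  obtain ⟨hC, hnd, hdv, hm⟩ := first_step hn hh hT hnu H
  obtain ⟨c1, c2, c3, c4⟩ := hC
  rcases step_inv hh H2 with ⟨h1, h2⟩ | ⟨h1, h2, h3⟩ | ⟨h1, h2, h3⟩
  · -- w = h
    have hl : ∀ x, x ∈ partsM lam ↔ (x = h ∨ x ∈ partsM nu) := by
      intro x; rw [h2, Multiset.mem_cons]
    by_cases hvh : v = h
    · right
      refine ⟨⟨c1, c2, c3, c4⟩, by omega, by omega, ?_⟩
      intro x hx hne
      rw [hl, hm]
      have := hpos x hx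
      right; right; right; exact ⟨hx, by omega⟩
    · left
      refine ⟨⟨c1, c2, c3, c4⟩, ⟨by omega, by rw [h1]; exact hnh, by omega, by omega⟩, by omega, ?_⟩
      intro x hx
      have := hpos x hx
      rw [hl, hm]
      constructor
      · rintro (h5 | h5 | h5 | h5)
        · rw [h5] at hx; exact absurd hx hnh
        · rw [h5] at hx; exact absurd hx c2
        · exfalso
          have h6 := c4 h5.1
          rw [show h - v = x by omega] at h6
          exact h6 hx
        · exact ⟨h5.2, by omega⟩
      · rintro ⟨h5, h6⟩
        right; right; right; exact ⟨hx, h5⟩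
  · -- w > h
    have hl : ∀ x, x ∈ partsM lam ↔ (x = w ∨ (x + h ≠ w ∧ x ∈ partsM nu)) := by
      intro x; rw [h3, Multiset.mem_cons, hnd.mem_erase_iff]
      constructor
      · rintro (h4 | h4)
        · exact Or.inl h4
        · exact Or.inr ⟨by omega, h4.2⟩
      · rintro (h4 | h4)
        · exact Or.inl h4
        · exact Or.inr ⟨by omega, h4.2⟩
    rcases (hm _).1 h2 with h5 | h5 | h5
    · right
      refine ⟨⟨c1, c2, c3, c4⟩, by omega, by omega, ?_⟩
      intro x hx hne
      rw [hl, hm]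
      right
      refine ⟨?_, Or.inr (Or.inr ⟨hx, by omega⟩)⟩
      intro h6
      rw [show x = v by omega] at hx; exact c2 hx
    · right
      refine ⟨⟨c1, c2, c3, c4⟩, by omega, by omega, ?_⟩
      intro x hx hne
      rw [hl, hm]
      right
      refine ⟨?_, Or.inr (Or.inr ⟨hx, by omega⟩)⟩
      intro h6
      rw [show x = h - v by omega] at hx; exact c4 h5.1 hx
    · have hd : ¬ h ∣ w := notdvd_sub h1 (hT.ndvd _ h5.1)
      have hw : w ∉ partsM nu := by
        intro hv
        have h4 := count_le hlam hd
        rw [h3, Multiset.count_cons_self] at h4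
        have h5 : w ∈ (partsM nu).erase (w - h) := by
          rw [Multiset.mem_erase_of_ne (by omega)]; exact hv
        have := Multiset.count_pos.2 h5
        omega
      rw [hm] at hw
      push Not at hw
      by_cases hwt : w ∈ partsM tau
      · have h6 := hw.2.2 hwt
        right
        refine ⟨⟨c1, c2, c3, c4⟩, by omega, by omega, ?_⟩
        intro x hx hne
        rw [hl, hm]
        by_cases h7 : x = w
        · exact Or.inl h7
        · right
          exact ⟨by omega, Or.inr (Or.inr ⟨hx, by omega⟩)⟩
      · left
        refine ⟨⟨c1, c2, c3, c4⟩, ⟨by omega, hwt, fun _ => h5.1, by omega⟩, by omega, ?_⟩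
        intro x hx
        rw [hl, hm]
        constructor
        · rintro (h6 | ⟨h6, h7 | h7 | h7⟩)
          · rw [h6] at hx; exact absurd hx hwt
          · rw [h7] at hx; exact absurd hx c2
          · exfalso
            have h8 := c4 h7.1
            rw [show h - v = x by omega] at h8
            exact h8 hx
          · exact ⟨h7.2, h6⟩
        · rintro ⟨h6, h7⟩
          exact Or.inr ⟨h7, Or.inr (Or.inr ⟨hx, h6⟩)⟩
  · -- w < h
    have hl : ∀ x, x ∈ partsM lam ↔ (x = w ∨ x = h - w ∨ x ∈ partsM nu) := by
      intro x; rw [h3, Multiset.mem_cons, Multiset.mem_cons]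
    have e1 := count_le hlam (notdvd_lt (v := w) (by omega) h2)
    have e2 := count_le hlam (notdvd_lt (h := h) (v := h - w) (by omega) (by omega))
    rw [h3, Multiset.count_cons_self] at e1
    rw [h3, Multiset.cons_swap, Multiset.count_cons_self] at e2
    have g1 : w ∉ (h - w) ::ₘ partsM nu := by
      intro h4; have := Multiset.count_pos.2 h4; omega
    have g2 : h - w ∉ w ::ₘ partsM nu := by
      intro h4; have := Multiset.count_pos.2 h4; omega
    have g3 : w ∉ partsM nu := fun h4 => g1 (Multiset.mem_cons_of_mem h4)
    have g4 : h - w ∉ partsM nu := fun h4 => g2 (Multiset.mem_cons_of_mem h4)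
    rw [hm] at g3 g4
    push Not at g3 g4
    by_cases k1 : w ∈ partsM tau
    · have h6 := g3.2.2 k1
      right
      refine ⟨⟨c1, c2, c3, c4⟩, by omega, by omega, ?_⟩
      intro x hx hne
      rw [hl, hm]
      by_cases h7 : x = w
      · exact Or.inl h7
      · exact Or.inr (Or.inr (Or.inr (Or.inr ⟨hx, by omega⟩)))
    by_cases k2 : h - w ∈ partsM tau
    · have h6 := g4.2.2 k2
      right
      refine ⟨⟨c1, c2, c3, c4⟩, by omega, by omega, ?_⟩
      intro x hx hne
      rw [hl, hm]
      by_cases h7 : x = h - w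
      · exact Or.inr (Or.inl h7)
      · exact Or.inr (Or.inr (Or.inr (Or.inr ⟨hx, by omega⟩)))
    left
    refine ⟨⟨c1, c2, c3, c4⟩, ⟨by omega, k1, by omega, fun _ => k2⟩, by omega, ?_⟩
    intro x hx
    rw [hl, hm]
    constructor
    · rintro (h6 | h6 | h7 | h7 | h7)
      · rw [h6] at hx; exact absurd hx k1
      · rw [h6] at hx; exact absurd hx k2
      · rw [h7] at hx; exact absurd hx c2
      · exfalso
        have h8 := c4 h7.1
        rw [show h - v = x by omega] at h8
        exact h8 hx
      · exact ⟨h7.2, by omega⟩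
    · rintro ⟨h6, h7⟩
      exact Or.inr (Or.inr (Or.inr (Or.inr ⟨hx, h6⟩)))

def cnt (T : Multiset ℕ) (l u : ℕ) : ℕ := ((Finset.Ico l u).filter (· ∈ T)).card

lemma cnt_right (T : Multiset ℕ) {l u : ℕ} (h : l ≤ u) :
    cnt T l (u + 1) = cnt T l u + (if u ∈ T then 1 else 0) := by
  unfold cnt
  rw [← Finset.insert_Ico_right_eq_Ico_add_one h, Finset.filter_insert]
  split_ifs
  · rw [Finset.card_insert_of_notMem (by simp)]
  · rfl

lemma cnt_left (T : Multiset ℕ) {l u : ℕ} (h : l < u) :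
    cnt T l u = cnt T (l + 1) u + (if l ∈ T then 1 else 0) := by
  unfold cnt
  rw [← Finset.insert_Ico_add_one_left_eq_Ico h, Finset.filter_insert]
  split_ifs
  · rw [Finset.card_insert_of_notMem (by simp)]
  · rfl

def Kf (h : ℕ) (T : Multiset ℕ) (c : ℕ) : ℕ :=
  if c ≤ h then h - c + 1 + cnt T (h - c + 1) c else cnt T (c - h) c

def LI (h c : ℕ) : Finset ℕ := if h ≤ c then Finset.Ioo (c - h) c else Finset.Ioo (h - c) c

def tl (h : ℕ) (T : Multiset ℕ) (c : ℕ) : ℕ := (h - c) + ((LI h c).filter (· ∈ T)).card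

lemma leg_formula (h : ℕ) (tau lam : BPartition) (c : ℕ) :
    legLen h tau lam c =
      (h - c) + ((LI h c).filter (fun x => x ∈ partsM lam ∧ x ∈ partsM tau)).card := by
  unfold legLen LI
  split_ifs with h1
  · rw [Nat.sub_eq_zero_of_le h1, zero_add, ← Set.ncard_coe_finset]
    congr 1; ext x; simp [and_assoc]
  · rw [← Set.ncard_coe_finset]
    congr 2; ext x; simp [and_assoc]

lemma leg_eq {h : ℕ} {tau lam : BPartition} {c : ℕ}
    (H : ∀ x ∈ LI h c, x ∈ partsM tau → x ∈ partsM lam) :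
    legLen h tau lam c = tl h (partsM tau) c := by
  rw [leg_formula, tl]
  congr 2
  apply Finset.filter_congr
  intro x hx
  exact ⟨fun h1 => h1.2, fun h1 => ⟨H x hx h1, h1⟩⟩

lemma leg_minus {h : ℕ} {tau lam : BPartition} {c y : ℕ} (hy : y ∈ LI h c)
    (hyt : y ∈ partsM tau) (hyl : y ∉ partsM lam)
    (H : ∀ x ∈ LI h c, x ∈ partsM tau → x ≠ y → x ∈ partsM lam) :
    legLen h tau lam c + 1 = tl h (partsM tau) c := by
  rw [leg_formula, tl]
  have : (LI h c).filter (· ∈ partsM tau) =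
      insert y ((LI h c).filter (fun x => x ∈ partsM lam ∧ x ∈ partsM tau)) := by
    ext x
    simp only [Finset.mem_insert, Finset.mem_filter]
    constructor
    · rintro ⟨h1, h2⟩
      by_cases h3 : x = y
      · exact Or.inl h3
      · exact Or.inr ⟨h1, H x h1 h2 h3, h2⟩
    · rintro (h1 | h1)
      · rw [h1]; exact ⟨hy, hyt⟩
      · exact ⟨h1.1, h1.2.2⟩
  rw [this, Finset.card_insert_of_notMem (by simp [hyl])]
  omega

lemma mem_LI {h c x : ℕ} : x ∈ LI h c ↔ (x < c ∧ ((h ≤ c ∧ c < x + h) ∨ (c < h ∧ h < x + c))) := by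
  unfold LI
  split_ifs with h1
  · rw [Finset.mem_Ioo]; omega
  · rw [Finset.mem_Ioo]; omega

lemma LI_card (h : ℕ) (T : Multiset ℕ) (c : ℕ) : ((LI h c).filter (· ∈ T)).card =
    if h ≤ c then cnt T (c - h + 1) c else cnt T (h - c + 1) c := by
  unfold LI cnt
  split_ifs <;> rfl

lemma tl_K1 {h : ℕ} {T : Multiset ℕ} {c : ℕ} (h0 : 0 < h) (H : h < c → c - h ∈ T) :
    tl h T c + 1 = Kf h T c := by
  rw [tl, LI_card, Kf]
  rcases lt_trichotomy c h with h1 | h1 | h1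
  · rw [if_neg (by omega), if_pos (by omega)]; omega
  · rw [if_pos (by omega), if_pos (by omega)]
    subst h1
    omega
  · rw [if_pos (by omega), if_neg (by omega), cnt_left T (show c - h < c by omega), if_pos (H h1)]
    omega

lemma tl_K2 {h : ℕ} {T : Multiset ℕ} {c : ℕ} (h0 : 0 < h) (hc : h ≤ c) (H : c ∉ T) :
    tl h T c = Kf h T (c + 1) := by
  rw [tl, LI_card, Kf, if_pos hc, if_neg (by omega), cnt_right T (by omega), if_neg H,
    show c + 1 - h = c - h + 1 by omega]
  omega

lemma Kf_le {h : ℕ} {T : Multiset ℕ} {c : ℕ} (hc : c ≤ h) :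
    Kf h T c = h - c + 1 + cnt T (h - c + 1) c := if_pos hc

lemma Kf_gt {h : ℕ} {T : Multiset ℕ} {c : ℕ} (hc : h < c) :
    Kf h T c = cnt T (c - h) c := if_neg (by omega)

open Classical in
lemma K_step {n h : ℕ} (hh : h = 2 * n + 1) {T : Multiset ℕ} (hT : Core h T) {c : ℕ} (hc : n < c) :
    Kf h T (c + 1) + (if Cpos n h T c then 1 else 0) = Kf h T c := by
  have hnh : h ∉ T := fun h1 => hT.ndvd h h1 (dvd_refl h)
  unfold Cpos
  rcases lt_trichotomy c h with h1 | h1 | h1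
  · have hp := hT.pair c
    rw [Kf_le (c := c + 1) (by omega), Kf_le (c := c) (by omega), cnt_right T (by omega),
      show h - (c + 1) + 1 = h - c by omega]
    rw [cnt_left T (show h - c < c by omega)]
    by_cases k1 : c ∈ T
    · have k2 : h - c ∉ T := fun k2 => hp k1 _ k2 (by omega)
      simp [k1, k2]; omega
    · by_cases k2 : h - c ∈ T
      · simp [k1, k2, h1]; omega
      · simp [k1, k2, hc, show ¬ h < c by omega]; omega
  · subst h1
    rw [Kf_gt (by omega), Kf_le (by omega), cnt_right T (by omega)]
    simp [hnh, hc]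
    omega
  · have hd := hT.down c
    rw [Kf_gt (c := c + 1) (by omega), Kf_gt (c := c) (by omega), cnt_right T (by omega),
      show c + 1 - h = c - h + 1 by omega, cnt_left T (show c - h < c by omega)]
    by_cases k1 : c ∈ T
    · have := hd k1 h1
      simp [k1, this]
    · by_cases k2 : c - h ∈ T
      · simp [k1, k2, hc, h1, show ¬ c < h by omega]
      · simp [k1, k2, h1]

lemma K_anti {n h : ℕ} (hh : h = 2 * n + 1) {T : Multiset ℕ} (hT : Core h T) {c d : ℕ} (hc : n < c)
    (hcd : c ≤ d) : Kf h T d ≤ Kf h T c := by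
  induction d, hcd using Nat.le_induction with
  | base => exact le_rfl
  | succ d hd ih =>
    have := K_step hh hT (show n < d by omega)
    omega

lemma K_C {n h : ℕ} (hh : h = 2 * n + 1) {T : Multiset ℕ} (hT : Core h T) {c : ℕ}
    (hc : Cpos n h T c) : Kf h T (c + 1) + 1 = Kf h T c := by
  have := K_step hh hT hc.1
  rwa [if_pos hc] at this

/-- summary of an element of the block with bar positions `a ≤ b` and difference `d` -/
def Summ (n h : ℕ) (T : Multiset ℕ) (a b d : ℕ) : Prop :=
  n < a ∧ a ≤ b ∧
  d + 1 + (if b < a + h ∧ 2 * h < a + b then 1 else 0) + Kf h T (b + 1) = Kf h T a ∧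
  ((Cpos n h T a ∧ Cpos n h T b) ∨
    ((b = a + h ∨ a + b = 2 * h) ∧ (Cpos n h T a ∨ Cpos n h T b)))

lemma summ_S {n h : ℕ} (hh : h = 2 * n + 1) {lam tau : BPartition} {a b : ℕ}
    (hT : Core h (partsM tau)) (hab : a < b)
    (ha : Cpos n h (partsM tau) a) (hb : Cpos n h (partsM tau) b)
    (hm : ∀ x ∈ partsM tau, (x ∈ partsM lam ↔ x + h ≠ a ∧ x + h ≠ b)) :
    Summ n h (partsM tau) a b (ddd h tau lam a b) := by
  have hna := ha.1
  refine ⟨hna, hab.le, ?_, Or.inl ⟨ha, hb⟩⟩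
  have k1 := K_C hh hT ha
  have k2 := K_C hh hT hb
  have k3 := K_anti hh hT (show n < a + 1 by omega) (show a + 1 ≤ b by omega)
  have t1 := tl_K1 (T := partsM tau) (show 0 < h by omega) ha.2.2.1
  have t2 := tl_K1 (T := partsM tau) (show 0 < h by omega) hb.2.2.1
  have l2 : legLen h tau lam b = tl h (partsM tau) b := by
    apply leg_eq
    intro x hx hxt
    rw [mem_LI] at hx
    rw [hm x hxt]; omega
  unfold ddd
  split_ifs with hε
  · have l1 : legLen h tau lam a + 1 = tl h (partsM tau) a := by
      have hbh : b - h ∈ partsM tau := hb.2.2.1 (by omega)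
      apply leg_minus (y := b - h)
      · rw [mem_LI]; omega
      · exact hbh
      · rw [hm _ hbh]; omega
      · intro x hx hxt hne
        rw [mem_LI] at hx
        rw [hm x hxt]; omega
    omega
  · have l1 : legLen h tau lam a = tl h (partsM tau) a := by
      apply leg_eq
      intro x hx hxt
      rw [mem_LI] at hx
      rw [hm x hxt]; omega
    omega

lemma summ_D {n h : ℕ} (hh : h = 2 * n + 1) {lam tau : BPartition} {a b : ℕ}
    (hT : Core h (partsM tau)) (hab : a ≤ b) (hna : n < a)
    (hr : b = a + h ∨ a + b = 2 * h)
    (hC : Cpos n h (partsM tau) a ∨ Cpos n h (partsM tau) b)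
    (hm : ∀ x ∈ partsM tau, x + h ≠ a → x ∈ partsM lam) :
    Summ n h (partsM tau) a b (ddd h tau lam a b) := by
  have hnh : h ∉ partsM tau := fun h1 => hT.ndvd h h1 (dvd_refl h)
  refine ⟨hna, hab, ?_, Or.inr ⟨hr, hC⟩⟩
  rw [if_neg (by omega)]
  have l1 : legLen h tau lam a = tl h (partsM tau) a := by
    apply leg_eq
    intro x hx hxt
    rw [mem_LI] at hx
    exact hm x hxt (by omega)
  have l2 : legLen h tau lam b = tl h (partsM tau) b := by
    apply leg_eq
    intro x hx hxt
    rw [mem_LI] at hx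
    exact hm x hxt (by omega)
  have t1 : tl h (partsM tau) a + 1 = Kf h (partsM tau) a := by
    apply tl_K1 (by omega)
    intro hlt
    rcases hC with hC | hC
    · exact hC.2.2.1 hlt
    · have h1 : a ∈ partsM tau := by
        have := hC.2.2.1 (by omega)
        rwa [show b - h = a by omega] at this
      exact hT.down a h1 hlt
  have t2 : tl h (partsM tau) b = Kf h (partsM tau) (b + 1) := by
    apply tl_K2 (by omega) (by omega)
    rcases hC with hC | hC
    · intro hbt
      rcases eq_or_lt_of_le (show h ≤ b by omega) with h1 | h1
      · rw [← h1] at hbt; exact hnh hbt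
      · have h2 := hT.down b hbt h1
        rcases hr with h3 | h3
        · rw [show b - h = a by omega] at h2
          exact hC.2.1 h2
        · rw [show b - h = h - a by omega] at h2
          exact hC.2.2.2 (by omega) h2
    · exact hC.2.1
  have k : Kf h (partsM tau) (b + 1) + 1 ≤ Kf h (partsM tau) a := by
    rcases hC with hC | hC
    · have := K_C hh hT hC
      have := K_anti hh hT (show n < a + 1 by omega) (show a + 1 ≤ b + 1 by omega)
      omega
    · have := K_C hh hT hC
      have := K_anti hh hT hna hab
      omega
  unfold ddd
  omega

lemma summ {n h : ℕ} (hn : 1 ≤ n) (hh : h = 2 * n + 1) {lam tau : BPartition} {a b : ℕ}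
    (hT : Core h (partsM tau)) (hlam : IsHStrict h lam) (H : BarPositions h tau lam a b) :
    Summ n h (partsM tau) a b (ddd h tau lam a b) ∧
    ∀ x, fsum (partsM lam) x = fsum (partsM tau) x + gf h a x + gf h b x := by
  obtain ⟨hab, nu, w, v, s1, s2, he⟩ := H
  have he' : (a = w ∧ b = v) ∨ (a = v ∧ b = w) := by
    have : (a ::ₘ {b} : Multiset ℕ) = w ::ₘ {v} := he
    rw [Multiset.cons_eq_cons] at this
    rcases this with ⟨h1, h2⟩ | ⟨h1, cs, h2, h3⟩
    · left; exact ⟨h1, Multiset.singleton_inj.1 h2⟩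
    · right
      rw [Multiset.singleton_eq_cons_iff] at h2 h3
      exact ⟨h3.1.symm, h2.1⟩
  constructor
  · rcases second_step hn hh hT s1.1 hlam s2 s1 with ⟨hv, hw, hne, hm⟩ | ⟨hv, hw, hr, hm⟩
    · rcases he' with ⟨rfl, rfl⟩ | ⟨rfl, rfl⟩
      · exact summ_S hh hT (by omega) hw hv (fun x hx => by rw [hm x hx, and_comm])
      · exact summ_S hh hT (by omega) hv hw hm
    · have hnv := hv.1
      rcases he' with ⟨rfl, rfl⟩ | ⟨rfl, rfl⟩
      · exact summ_D hh hT hab hw (by omega) (Or.inr hv)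
          (fun x hx hne => hm x hx (by rwa [min_eq_right hab]))
      · exact summ_D hh hT hab hnv (by omega) (Or.inl hv)
          (fun x hx hne => hm x hx (by rwa [min_eq_left hab]))
  · intro x
    have e1 := fsum_step hh s1 x
    have e2 := fsum_step hh s2 x
    rcases he' with ⟨rfl, rfl⟩ | ⟨rfl, rfl⟩ <;> omega

lemma gf_mono {n h : ℕ} (hh : h = 2 * n + 1) {c d : ℕ} (hc : n < c) (hcd : c ≤ d) (x : ℕ) :
    gf h c x ≤ gf h d x := by
  unfold gf
  split_ifs <;> omega

lemma gf_nest {n h : ℕ} (hh : h = 2 * n + 1) {a1 a2 b2 b1 : ℕ} (h1 : n < a1) (h2 : a1 < a2)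
    (h3 : a2 ≤ b2) (h4 : b2 < b1) (h5 : a2 + b2 ≤ 2 * h) (h6 : a2 + b2 ≤ a1 + b1) (x : ℕ) :
    gf h a2 x + gf h b2 x ≤ gf h a1 x + gf h b1 x := by
  unfold gf
  split_ifs <;> omega

lemma nested {n h : ℕ} (hh : h = 2 * n + 1) {T : Multiset ℕ} (hT : Core h T)
    {a1 b1 d1 a2 b2 d2 : ℕ} (S1 : Summ n h T a1 b1 d1) (S2 : Summ n h T a2 b2 d2)
    (ha : a1 < a2) (hb : b2 < b1) (hi : 2 * h < a2 + b2 ∨ a1 + b1 < a2 + b2) : d2 + 2 ≤ d1 := by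
  obtain ⟨p1, p2, p3, p4⟩ := S1
  obtain ⟨q1, q2, q3, -⟩ := S2
  have ka := K_anti hh hT p1 (show a1 ≤ a2 by omega)
  have kb := K_anti hh hT (show n < b2 + 1 by omega) (show b2 + 1 ≤ b1 + 1 by omega)
  have ka' : Cpos n h T a1 → Kf h T a2 + 1 ≤ Kf h T a1 := by
    intro hC
    have := K_C hh hT hC
    have := K_anti hh hT (show n < a1 + 1 by omega) (show a1 + 1 ≤ a2 by omega)
    omega
  have kb' : Cpos n h T b1 → Kf h T (b1 + 1) + 1 ≤ Kf h T (b2 + 1) := by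
    intro hC
    have := K_C hh hT hC
    have := K_anti hh hT (show n < b2 + 1 by omega) (show b2 + 1 ≤ b1 by omega)
    omega
  rcases p4 with ⟨hC1, hC2⟩ | ⟨hr, hC⟩
  · have := ka' hC1
    have := kb' hC2
    split_ifs at p3 q3 <;> omega
  · have : Kf h T a2 + Kf h T (b1 + 1) + 1 ≤ Kf h T a1 + Kf h T (b2 + 1) := by
      rcases hC with hC | hC
      · have := ka' hC; omega
      · have := kb' hC; omega
    rw [if_neg (by omega)] at p3
    rw [if_pos (by omega)] at q3
    omega

lemma half {n h : ℕ} (hn : 1 ≤ n) (hh : h = 2 * n + 1) {lam mu tau : BPartition}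
    {a1 b1 a2 b2 : ℕ} (hT : Core h (partsM tau)) (hlam : IsHStrict h lam) (hmu : IsHStrict h mu)
    (H1 : BarPositions h tau lam a1 b1) (H2 : BarPositions h tau mu a2 b2)
    (hd : ¬ domLE mu lam) (ha : a1 < a2) (hb : b2 < b1) :
    ddd h tau mu a2 b2 + 2 ≤ ddd h tau lam a1 b1 := by
  obtain ⟨S1, F1⟩ := summ hn hh hT hlam H1
  obtain ⟨S2, F2⟩ := summ hn hh hT hmu H2
  refine nested hh hT S1 S2 ha hb ?_
  by_contra hcon
  apply hd
  apply dom_of_fsum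
  intro x
  have := gf_nest hh S1.1 ha S2.2.1 hb (by omega) (by omega) x
  rw [F1, F2]
  omega

end Bar12

open BPartition in
/-- If λ, μ ∈ P_{τ,2} are incomparable in the dominance order then |∂λ − ∂μ| ≥ 2. -/
theorem stmt12 (n h : ℕ) (hn : 1 ≤ n) (hh : h = 2 * n + 1)
    (tau lam mu : BPartition) (h1 : InBlock h tau 2 lam) (h2 : InBlock h tau 2 mu)
    (hinc : ¬ domLE lam mu ∧ ¬ domLE mu lam)
    (a₁ b₁ a₂ b₂ : ℕ) (hb1 : BarPositions h tau lam a₁ b₁)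
    (hb2 : BarPositions h tau mu a₂ b₂) :
    2 ≤ ((ddd h tau lam a₁ b₁ : ℤ) - (ddd h tau mu a₂ b₂ : ℤ)).natAbs := by
  have hT := Bar12.core_of hh h1.2.1
  obtain ⟨S1, F1⟩ := Bar12.summ hn hh hT h1.1 hb1
  obtain ⟨S2, F2⟩ := Bar12.summ hn hh hT h2.1 hb2
  have c1 : ¬ (a₁ ≤ a₂ ∧ b₁ ≤ b₂) := by
    rintro ⟨ha, hb⟩
    apply hinc.1
    apply Bar12.dom_of_fsum
    intro x
    have e1 := Bar12.gf_mono hh S1.1 ha x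
    have e2 := Bar12.gf_mono hh (lt_of_lt_of_le S1.1 S1.2.1) hb x
    rw [F1, F2]
    omega
  have c2 : ¬ (a₂ ≤ a₁ ∧ b₂ ≤ b₁) := by
    rintro ⟨ha, hb⟩
    apply hinc.2
    apply Bar12.dom_of_fsum
    intro x
    have e1 := Bar12.gf_mono hh S2.1 ha x
    have e2 := Bar12.gf_mono hh (lt_of_lt_of_le S2.1 S2.2.1) hb x
    rw [F1, F2]
    omega
  rcases lt_or_ge a₁ a₂ with ha | ha
  · have := Bar12.half hn hh hT h1.1 h2.1 hb1 hb2 hinc.2 ha (by omega)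
    omega
  · have := Bar12.half hn hh hT h2.1 h1.1 hb2 hb1 hinc.1 (by omega) (by omega)
    omega
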